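/- Assume μ ≥ 0, 0 ≤ λ n for all n, λ n ≤ λ 0 for all n, and c = λ 0 + μ > 0. Then for every real t ≥ 0 and every index n, the function i ↦ (c^i · t^i / i!) · exp(−c·t) · h i n (from ℕ to ℝ) has nonnegative terms, is summable, and its sum lies in the interval [0, 1]. -/

import Mathlib

open Matrix

/-- The truncated defective infinitesimal generator of the state-dependent M/M/1-PS queue
arising from single-queue analysis of the M/M/R-JSQ-PS system.  The matrix has size
`(N+1) × (N+1)` (so at least `1 × 1`), diagonal entries `-(λ n + μ)`, superdiagonal entries
`λ n`, subdiagonal entries `(n/(n+1)) · μ`, and all other entries `0`. -/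
noncomputable def genD {N : ℕ} (lam : Fin (N + 1) → ℝ) (μ : ℝ) :
    Matrix (Fin (N + 1)) (Fin (N + 1)) ℝ :=
  Matrix.of fun i j =>
    if (j : ℕ) = (i : ℕ) then -(lam i + μ)
    else if (j : ℕ) = (i : ℕ) + 1 then lam i
    else if (j : ℕ) + 1 = (i : ℕ) then ((i : ℕ) : ℝ) / ((i : ℕ) + 1) * μ
    else 0

/-- The uniformisation vectors `h i = (I + c⁻¹ D)^i e`, defined recursively by `h 0 = e`
(the all-ones vector) and `h (i+1) = (I + c⁻¹ • D) ·ᵥ h i`. -/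
noncomputable def hvec {N : ℕ} (lam : Fin (N + 1) → ℝ) (μ c : ℝ) : ℕ → Fin (N + 1) → ℝ
  | 0 => fun _ => 1
  | i + 1 => ((1 : Matrix (Fin (N + 1)) (Fin (N + 1)) ℝ) + c⁻¹ • genD lam μ) *ᵥ
      hvec lam μ c i

/-- A nonnegative matrix whose row sums are at most one maps `[0, 1]`-valued vectors to
`[0, 1]`-valued vectors. -/
theorem mulVec_mem_Icc_of_sum_le_one {ι κ : Type*} [Fintype κ] {A : Matrix ι κ ℝ}
    (hA : ∀ i j, 0 ≤ A i j) (hsum : ∀ i, ∑ j, A i j ≤ 1) {v : κ → ℝ}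
    (hv : ∀ j, v j ∈ Set.Icc (0 : ℝ) 1) (i : ι) : (A *ᵥ v) i ∈ Set.Icc (0 : ℝ) 1 := by
  refine ⟨Finset.sum_nonneg fun j _ => mul_nonneg (hA i j) (hv j).1, ?_⟩
  exact (Finset.sum_le_sum fun j _ => mul_le_of_le_one_right (hA i j) (hv j).2).trans (hsum i)

theorem sum_ite_le_of_subsingleton {ι : Type*} [Fintype ι] (p : ι → Prop) [DecidablePred p]
    (hp : ∀ i j, p i → p j → i = j) {a : ℝ} (ha : 0 ≤ a) :
    ∑ i, (if p i then a else 0) ≤ a := by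
  have hcard : (Finset.univ.filter p).card ≤ 1 :=
    Finset.card_le_one.2 fun i hi j hj => hp i j (by simpa using hi) (by simpa using hj)
  rw [← Finset.sum_filter, Finset.sum_const, nsmul_eq_mul]
  exact mul_le_of_le_one_left ha (by exact_mod_cast hcard)

theorem sum_genD_le_zero {N : ℕ} {lam : Fin (N + 1) → ℝ} {μ : ℝ} (hμ : 0 ≤ μ)
    (hlam : ∀ n, 0 ≤ lam n) (i : Fin (N + 1)) : ∑ j, genD lam μ i j ≤ 0 := by
  have hdeath : 0 ≤ ((i : ℕ) : ℝ) / ((i : ℕ) + 1) * μ := by positivity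
  have hsplit : ∀ j, genD lam μ i j = (if j = i then -(lam i + μ) else 0)
      + (if (j : ℕ) = (i : ℕ) + 1 then lam i else 0)
      + (if (j : ℕ) + 1 = (i : ℕ) then ((i : ℕ) : ℝ) / ((i : ℕ) + 1) * μ else 0) := by
    intro j
    simp only [genD, of_apply, Fin.ext_iff]
    split_ifs <;> first | omega | simp
  simp only [hsplit, Finset.sum_add_distrib, Finset.sum_ite_eq', Finset.mem_univ, if_true]
  have hup := sum_ite_le_of_subsingleton (fun j : Fin (N + 1) => (j : ℕ) = (i : ℕ) + 1)
    (fun a b _ _ => Fin.ext (by omega)) (hlam i)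
  have hdown := sum_ite_le_of_subsingleton (fun j : Fin (N + 1) => (j : ℕ) + 1 = (i : ℕ))
    (fun a b _ _ => Fin.ext (by omega)) hdeath
  have hle : ((i : ℕ) : ℝ) / ((i : ℕ) + 1) * μ ≤ μ :=
    mul_le_of_le_one_left hμ ((div_le_one (by positivity)).2 (by linarith))
  linarith

theorem one_add_smul_genD_nonneg {N : ℕ} {lam : Fin (N + 1) → ℝ} {μ c : ℝ} (hμ : 0 ≤ μ)
    (hlam : ∀ n, 0 ≤ lam n) (hle : ∀ n, lam n + μ ≤ c) (hc : 0 < c) (i j : Fin (N + 1)) :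
    0 ≤ ((1 : Matrix (Fin (N + 1)) (Fin (N + 1)) ℝ) + c⁻¹ • genD lam μ) i j := by
  rw [Matrix.add_apply, Matrix.smul_apply, smul_eq_mul]
  rcases eq_or_ne i j with rfl | hij
  · have : c⁻¹ * (lam i + μ) ≤ 1 := by
      rw [inv_mul_le_iff₀ hc, mul_one]
      exact hle i
    simp only [one_apply_eq, genD, of_apply, if_true]
    linarith
  · have hne : (j : ℕ) ≠ i := fun h => hij (Fin.ext h.symm)
    have := hlam i
    simp only [one_apply_ne hij, genD, of_apply, hne, if_false]
    split_ifs <;> positivity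

theorem hvec_mem_Icc {N : ℕ} {lam : Fin (N + 1) → ℝ} {μ c : ℝ} (hμ : 0 ≤ μ)
    (hlam : ∀ n, 0 ≤ lam n) (hle : ∀ n, lam n + μ ≤ c) (hc : 0 < c) (i : ℕ)
    (n : Fin (N + 1)) : hvec lam μ c i n ∈ Set.Icc (0 : ℝ) 1 := by
  induction i generalizing n with
  | zero => simp [hvec]
  | succ i ih =>
    refine mulVec_mem_Icc_of_sum_le_one (one_add_smul_genD_nonneg hμ hlam hle hc)
      (fun k => ?_) ih n
    have : c⁻¹ * ∑ j, genD lam μ k j ≤ 0 :=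
      mul_nonpos_of_nonneg_of_nonpos (inv_pos.2 hc).le (sum_genD_le_zero hμ hlam k)
    simp only [Matrix.add_apply, Matrix.smul_apply, smul_eq_mul, Finset.sum_add_distrib,
      ← Finset.mul_sum, one_apply, Finset.sum_ite_eq, Finset.mem_univ, if_true]
    linarith

theorem hasSum_pow_mul_pow_div_factorial_mul_exp_neg (c t : ℝ) :
    HasSum (fun i : ℕ => c ^ i * t ^ i / (Nat.factorial i) * Real.exp (-(c * t))) 1 := by
  have h := (NormedSpace.expSeries_div_hasSum_exp (c * t)).mul_right (Real.exp (-(c * t)))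
  rw [← Real.exp_eq_exp_ℝ, ← Real.exp_add, add_neg_cancel, Real.exp_zero] at h
  simpa only [mul_pow] using h

/-- **The uniformisation series is a probability.**  Under the hypotheses `μ ≥ 0`,
`0 ≤ λ n`, `λ n ≤ λ 0` and `c = λ 0 + μ > 0`, for every `t ≥ 0` and every index `n` the
sequence `i ↦ (cⁱ tⁱ / i!) · exp (−c t) · h i n` has nonnegative terms, is summable, and
its sum lies in `[0, 1]` (it is the conditional complementary sojourn-time CDF `wₙ(t)`). -/
theorem uniformisation_series_nonneg_summable_le_one {N : ℕ} (lam : Fin (N + 1) → ℝ)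
    (μ c : ℝ) (hμ : 0 ≤ μ) (hlam : ∀ n, 0 ≤ lam n) (hlam0 : ∀ n, lam n ≤ lam 0)
    (hc_def : c = lam 0 + μ) (hc : 0 < c) (t : ℝ) (ht : 0 ≤ t) (n : Fin (N + 1)) :
    (∀ i : ℕ, 0 ≤ c ^ i * t ^ i / (Nat.factorial i) * Real.exp (-(c * t)) * hvec lam μ c i n)
    ∧ Summable (fun i : ℕ =>
        c ^ i * t ^ i / (Nat.factorial i) * Real.exp (-(c * t)) * hvec lam μ c i n)
    ∧ (∑' i : ℕ,
        c ^ i * t ^ i / (Nat.factorial i) * Real.exp (-(c * t)) * hvec lam μ c i n)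
        ∈ Set.Icc (0 : ℝ) 1 := by
  have hh := fun i => hvec_mem_Icc hμ hlam
    (fun k => hc_def ▸ add_le_add_left (hlam0 k) μ) hc i n
  have hw : ∀ i : ℕ, 0 ≤ c ^ i * t ^ i / (Nat.factorial i) * Real.exp (-(c * t)) :=
    fun i => by positivity
  have hsum := hasSum_pow_mul_pow_div_factorial_mul_exp_neg c t
  have hnonneg := fun i => mul_nonneg (hw i) (hh i).1
  have hbound := fun i => mul_le_of_le_one_right (hw i) (hh i).2
  have hs := Summable.of_nonneg_of_le hnonneg hbound hsum.summable
  exact ⟨hnonneg, hs, tsum_nonneg hnonneg, hasSum_le hbound hs.hasSum hsum⟩
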